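/- For all real r > 1 and all φ ∈ [0, 2π]: Σ_{j=1}^∞ |sin(jφ)| r^{−j} ≤ (1/π)·(r+1)/(r−1). -/

import Mathlib

/-- The coefficient of `exp (2 * i * n * x)` in the Fourier expansion of `|sin x|`. -/
noncomputable def absSinCoeff (n : ℤ) : ℝ := 2 / Real.pi / (1 - 4 * (n : ℝ) ^ 2)

lemma one_sub_four_mul_int_sq_neg {n : ℤ} (hn : n ≠ 0) : 1 - 4 * (n : ℝ) ^ 2 < 0 := by
  have h : (1 : ℝ) ≤ (n : ℝ) ^ 2 := by
    exact_mod_cast Int.add_one_le_iff.mpr (by positivity : 0 < n ^ 2)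
  linarith

lemma one_sub_four_mul_int_sq_ne_zero (n : ℤ) : 1 - 4 * (n : ℝ) ^ 2 ≠ 0 := by
  rcases eq_or_ne n 0 with rfl | hn
  · norm_num
  · exact (one_sub_four_mul_int_sq_neg hn).ne

lemma absSinCoeff_neg {n : ℤ} (hn : n ≠ 0) : absSinCoeff n < 0 :=
  div_neg_of_pos_of_neg (by positivity) (one_sub_four_mul_int_sq_neg hn)

lemma summable_absSinCoeff : Summable absSinCoeff := by
  refine Summable.of_norm_bounded_eventually
    ((Real.summable_one_div_int_pow.mpr one_lt_two).mul_left (2 / Real.pi)) ?_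
  filter_upwards [(Set.finite_singleton (0 : ℤ)).compl_mem_cofinite] with n hn
  have hn : n ≠ 0 := hn
  have h : (1 : ℝ) ≤ (n : ℝ) ^ 2 := by
    exact_mod_cast Int.add_one_le_iff.mpr (by positivity : 0 < n ^ 2)
  rw [absSinCoeff, norm_div, Real.norm_of_nonneg (by positivity), div_eq_mul_one_div,
    Real.norm_of_nonpos (one_sub_four_mul_int_sq_neg hn).le]
  gcongr
  linarith

/-- The function `|sin x|` on the circle of length `π`. -/
noncomputable def absSinCircle : C(AddCircle Real.pi, ℂ) where
  toFun := Function.Periodic.lift (f := fun x : ℝ => ((|Real.sin x| : ℝ) : ℂ)) (c := Real.pi)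
    (fun x => by simp [Real.sin_add_pi])
  continuous_toFun := by
    refine continuous_coinduced_dom.mpr ?_
    change Continuous fun x : ℝ => ((|Real.sin x| : ℝ) : ℂ)
    fun_prop

lemma absSinCircle_coe (x : ℝ) : absSinCircle (x : AddCircle Real.pi) = ((|Real.sin x| : ℝ) : ℂ) :=
  rfl

lemma hasDerivAt_exp_mul_sin_antideriv (c : ℂ) (x : ℝ) :
    HasDerivAt (fun y : ℝ => Complex.exp (c * y) * (c * Complex.sin y - Complex.cos y))
      ((c ^ 2 + 1) * (Complex.exp (c * x) * Complex.sin x)) x := by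
  have h : HasDerivAt (fun z : ℂ => Complex.exp (c * z) * (c * Complex.sin z - Complex.cos z))
      ((c ^ 2 + 1) * (Complex.exp (c * x) * Complex.sin x)) (x : ℂ) := by
    convert! ((hasDerivAt_id (x : ℂ)).const_mul c).cexp.mul
      (((Complex.hasDerivAt_sin (x : ℂ)).const_mul c).sub (Complex.hasDerivAt_cos (x : ℂ))) using 1
    simp only [id, Pi.sub_apply]
    ring
  exact h.comp_ofReal

section

local instance : Fact (0 < Real.pi) := ⟨Real.pi_pos⟩

lemma fourier_pi_coe (n : ℤ) (x : ℝ) :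
    fourier n (x : AddCircle Real.pi) = Complex.exp (2 * n * Complex.I * x) := by
  rw [fourier_coe_apply]
  congr 1
  have : (Real.pi : ℂ) ≠ 0 := by exact_mod_cast Real.pi_ne_zero
  field_simp

lemma fourierCoeff_absSinCircle (n : ℤ) :
    fourierCoeff absSinCircle n = (absSinCoeff n : ℂ) := by
  have hne : (1 - 4 * (n : ℂ) ^ 2) ≠ 0 := by
    exact_mod_cast one_sub_four_mul_int_sq_ne_zero n
  set c : ℂ := 2 * ((-n : ℤ) : ℂ) * Complex.I with hc
  have hc2 : c ^ 2 + 1 = 1 - 4 * (n : ℂ) ^ 2 := by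
    rw [hc]
    push_cast
    linear_combination 4 * (n : ℂ) ^ 2 * Complex.I_sq
  have hexp : Complex.exp (c * Real.pi) = 1 := by
    rw [Complex.exp_eq_one_iff]
    exact ⟨-n, by rw [hc]; ring⟩
  have hint : (c ^ 2 + 1) * ∫ x in (0 : ℝ)..Real.pi, Complex.exp (c * x) * Complex.sin x = 2 := by
    rw [← intervalIntegral.integral_const_mul,
      intervalIntegral.integral_eq_sub_of_hasDerivAt
        (fun x _ => hasDerivAt_exp_mul_sin_antideriv c x)
        (Continuous.intervalIntegrable (by fun_prop) _ _), hexp]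
    simp
    norm_num
  rw [fourierCoeff_eq_intervalIntegral _ _ 0, zero_add]
  have hcongr : ∫ x in (0 : ℝ)..Real.pi,
      fourier (-n) (x : AddCircle Real.pi) • absSinCircle (x : AddCircle Real.pi) =
      ∫ x in (0 : ℝ)..Real.pi, Complex.exp (c * x) * Complex.sin x := by
    refine intervalIntegral.integral_congr fun x hx => ?_
    rw [Set.uIcc_of_le Real.pi_pos.le] at hx
    simp only [fourier_pi_coe, absSinCircle_coe, smul_eq_mul, ← hc,
      abs_of_nonneg (Real.sin_nonneg_of_mem_Icc hx), Complex.ofReal_sin]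
  rw [hcongr, Complex.real_smul]
  rw [hc2] at hint
  have hpi : (Real.pi : ℂ) ≠ 0 := by exact_mod_cast Real.pi_ne_zero
  rw [eq_div_of_mul_eq hne ((mul_comm _ _).trans hint), absSinCoeff]
  push_cast
  field_simp

lemma hasSum_absSinCoeff_mul_cos (x : ℝ) :
    HasSum (fun n : ℤ => absSinCoeff n * Real.cos (2 * n * x)) |Real.sin x| := by
  have hs : Summable (fourierCoeff absSinCircle) := by
    rw [funext fourierCoeff_absSinCircle]
    exact Complex.ofRealCLM.summable summable_absSinCoeff
  have h := Complex.hasSum_re (has_pointwise_sum_fourier_series_of_summable hs (x : AddCircle Real.pi))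
  convert! h using 1
  funext n
  have harg : (2 * n * Complex.I * x : ℂ) = ((2 * n * x : ℝ) : ℂ) * Complex.I := by
    push_cast
    ring
  rw [fourierCoeff_absSinCircle, fourier_pi_coe, smul_eq_mul, Complex.re_ofReal_mul, harg,
    Complex.exp_ofReal_mul_I_re]

end

lemma neg_half_le_re_div_one_sub {z : ℂ} (hz : ‖z‖ < 1) : -(1 / 2) ≤ (z / (1 - z)).re := by
  have hz1 : 1 - z ≠ 0 := by
    intro h
    rw [← sub_eq_zero.mp h] at hz
    simp at hz
  have hpos : 0 < Complex.normSq (1 - z) := Complex.normSq_pos.mpr hz1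
  have hsq : Complex.normSq z < 1 := by
    rw [Complex.normSq_eq_norm_sq]
    exact pow_lt_one₀ (norm_nonneg z) hz two_ne_zero
  rw [Complex.div_re, ← add_div, le_div_iff₀ hpos]
  simp only [Complex.normSq_apply, Complex.sub_re, Complex.sub_im, Complex.one_re,
    Complex.one_im] at hsq ⊢
  nlinarith

lemma neg_half_le_tsum_pow_mul_cos {q : ℝ} (hq0 : 0 ≤ q) (hq1 : q < 1) (θ : ℝ) :
    -(1 / 2) ≤ ∑' j : ℕ, Real.cos ((j + 1) * θ) * q ^ (j + 1) := by
  set z : ℂ := q * Complex.exp (θ * Complex.I) with hz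
  have hnorm : ‖z‖ < 1 := by
    rw [hz, norm_mul, Complex.norm_exp_ofReal_mul_I, mul_one, Complex.norm_real,
      Real.norm_of_nonneg hq0]
    exact hq1
  have h := Complex.hasSum_re ((hasSum_geometric_of_norm_lt_one hnorm).mul_left z)
  have hterm (j : ℕ) : (z * z ^ j).re = Real.cos ((j + 1) * θ) * q ^ (j + 1) := by
    have harg : ((j + 1 : ℕ) : ℂ) * (θ * Complex.I) = (((j + 1) * θ : ℝ) : ℂ) * Complex.I := by
      push_cast
      ring
    rw [← pow_succ', hz, mul_pow, ← Complex.exp_nat_mul, harg, ← Complex.ofReal_pow,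
      Complex.re_ofReal_mul, Complex.exp_ofReal_mul_I_re, mul_comm]
  simp only [hterm] at h
  rw [h.tsum_eq, ← div_eq_mul_inv]
  exact neg_half_le_re_div_one_sub hnorm

lemma tsum_abs_sin_mul_pow_le {q : ℝ} (hq0 : 0 ≤ q) (hq1 : q < 1) (φ : ℝ) :
    ∑' j : ℕ, |Real.sin ((j + 1) * φ)| * q ^ (j + 1) ≤ 1 / Real.pi * ((1 + q) / (1 - q)) := by
  have hgeom : HasSum (fun j : ℕ => q ^ (j + 1)) (q / (1 - q)) := by
    simpa only [pow_succ', div_eq_mul_inv] using (hasSum_geometric_of_lt_one hq0 hq1).mul_left q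
  set K : ℤ → ℝ := fun n => ∑' j : ℕ, Real.cos ((j + 1) * (2 * n * φ)) * q ^ (j + 1) with hK
  have hsum : Summable fun p : ℕ × ℤ =>
      absSinCoeff p.2 * (Real.cos ((p.1 + 1) * (2 * p.2 * φ)) * q ^ (p.1 + 1)) := by
    refine Summable.of_norm_bounded
      (hgeom.summable.mul_of_nonneg summable_absSinCoeff.norm
        (fun j => by positivity) (fun n => norm_nonneg _)) fun p => ?_
    rw [norm_mul, norm_mul, Real.norm_of_nonneg (by positivity : 0 ≤ q ^ (p.1 + 1)), mul_comm]
    gcongr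
    exact mul_le_of_le_one_left (by positivity) (Real.abs_cos_le_one _)
  have hrow (j : ℕ) : |Real.sin ((j + 1) * φ)| * q ^ (j + 1) =
      ∑' n : ℤ, absSinCoeff n * (Real.cos ((j + 1) * (2 * n * φ)) * q ^ (j + 1)) := by
    rw [← ((hasSum_absSinCoeff_mul_cos ((j + 1) * φ)).mul_right (q ^ (j + 1))).tsum_eq]
    refine tsum_congr fun n => ?_
    rw [mul_assoc, mul_left_comm (2 * (n : ℝ))]
  have hswap : ∑' j : ℕ, |Real.sin ((j + 1) * φ)| * q ^ (j + 1) = ∑' n, absSinCoeff n * K n := by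
    rw [tsum_congr hrow, Summable.tsum_comm hsum.prod_symm]
    exact tsum_congr fun n => tsum_mul_left
  have hKsum : Summable fun n => absSinCoeff n * K n := by
    simpa only [hK, Prod.fst_swap, Prod.snd_swap, tsum_mul_left] using hsum.prod_symm.prod
  have hzero : HasSum absSinCoeff 0 := by simpa using hasSum_absSinCoeff_mul_cos 0
  have hle := hasSum_le (f := fun n => absSinCoeff n * K n + absSinCoeff n * (1 / 2))
    (g := Pi.single 0 (absSinCoeff 0 * (q / (1 - q) + 1 / 2))) (fun n => ?_)
    (hKsum.hasSum.add (hzero.mul_right (1 / 2))) (hasSum_pi_single 0 _)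
  · rw [zero_mul, add_zero] at hle
    rw [hswap]
    refine hle.trans_eq ?_
    have : 1 - q ≠ 0 := by linarith
    simp only [absSinCoeff, Int.cast_zero]
    field_simp
    ring
  · rcases eq_or_ne n 0 with rfl | hn
    · simp [hK, hgeom.tsum_eq, mul_add]
    · rw [Pi.single_eq_of_ne hn, ← mul_add]
      have := neg_half_le_tsum_pow_mul_cos hq0 hq1 (2 * n * φ)
      exact mul_nonpos_of_nonpos_of_nonneg (absSinCoeff_neg hn).le (by simp only [hK]; linarith)

theorem sin_series_isodiametric_inequality (r : ℝ) (hr : 1 < r)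
    (φ : ℝ) (hφ : φ ∈ Set.Icc 0 (2 * Real.pi)) :
    (∑' j : ℕ, |Real.sin ((j + 1) * φ)| * r⁻¹ ^ (j + 1)) ≤
      (1 / Real.pi) * ((r + 1) / (r - 1)) := by
  have hr0 : 0 < r := one_pos.trans hr
  refine (tsum_abs_sin_mul_pow_le (inv_nonneg.mpr hr0.le) (inv_lt_one_of_one_lt₀ hr) φ).trans_eq ?_
  have h1 : r - 1 ≠ 0 := by linarith
  have h2 : 1 - r⁻¹ ≠ 0 := by linarith [inv_lt_one_of_one_lt₀ hr]
  congr 1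
  rw [div_eq_div_iff h2 h1]
  field_simp
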